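/- Bäcklund transformation s_1: Suppose α0,α1,α2,α3,α4 ∈ ℂ satisfy α0+2α1+3α2+2α3+α4 = 1, and (x(t),y(t),z(t),w(t)) is a differentiable solution of the coupled Painlevé VI system dx/dt = ∂H/∂y, dy/dt = −∂H/∂x, dz/dt = ∂H/∂w, dw/dt = −∂H/∂z on a domain avoiding t ∈ {0,1}, with x(t) ≠ 0 throughout. Then (x, y − α1/x, z, w) is a solution of the same system with parameters (α0+α1, −α1, α2+α1, α3, α4). -/

import Mathlib

noncomputable section

/-- The polynomial Hamiltonian `H` of the coupled Painlevé VI system of type `E₆⁽²⁾`,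
defined by `t(1-t)H = ...`. -/
def H (a0 a1 a2 a3 a4 t x y z w : ℂ) : ℂ :=
  (t * (1 - t))⁻¹ *
    (x ^ 2 * y ^ 3 + ((1 - 2 * t) * x - 2 * a1 - a2 - a3) * x * y ^ 2
      + ((t - 1) * t * x ^ 2
          + ((4 * a1 + 4 * a2 + 3 * a3 + a4) * t - (2 * a1 + 2 * a2 + 2 * a3 + a4)) * x
          + a1 * (a1 + a2 + a3)) * y
      - (1 - t) * t * a0 * x
      + (1 / 4) * (-(z ^ 2 * w ^ 4) + 2 * a3 * z * w ^ 3
          + ((1 + t) * z ^ 2 + 2 * (2 * a1 + 2 * a2 + a3) * z - a3 ^ 2) * w ^ 2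
          - 2 * (((-(2 * a1) - 2 * a2 - a3 - a4) * t + (2 * a1 + 2 * a2 + 2 * a3 + a4)) * z
              + a3 * (2 * a1 + 2 * a2 + a3)) * w
          - t * (z + 4 * a1 + 4 * a2 + 2 * a3) * z)
      + (t * x * z + (1 - t) * x * z * w - x * z * w ^ 2 - x * y * z + x * y * z * w
          - a1 * (w - 1) * z + a3 * x * w) * y)

/-- Partial derivative `∂H/∂x`. -/
def Hx (a0 a1 a2 a3 a4 t x y z w : ℂ) : ℂ :=
  deriv (fun s => H a0 a1 a2 a3 a4 t s y z w) x

/-- Partial derivative `∂H/∂y`. -/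
def Hy (a0 a1 a2 a3 a4 t x y z w : ℂ) : ℂ :=
  deriv (fun s => H a0 a1 a2 a3 a4 t x s z w) y

/-- Partial derivative `∂H/∂z`. -/
def Hz (a0 a1 a2 a3 a4 t x y z w : ℂ) : ℂ :=
  deriv (fun s => H a0 a1 a2 a3 a4 t x y s w) z

/-- Partial derivative `∂H/∂w`. -/
def Hw (a0 a1 a2 a3 a4 t x y z w : ℂ) : ℂ :=
  deriv (fun s => H a0 a1 a2 a3 a4 t x y z s) w

end

/-- The Hamiltonian is invariant under `s₁` up to a term depending only on `t`. -/
theorem H_s1 (a0 a1 a2 a3 a4 t x y z w : ℂ) (hx : x ≠ 0) :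
    H (a0 + a1) (-a1) (a2 + a1) a3 a4 t x (y - a1 / x) z w =
      H a0 a1 a2 a3 a4 t x y z w +
        (t * (1 - t))⁻¹ * ((1 - 2 * t) * a1 ^ 2
          - a1 * ((4 * a2 + 3 * a3 + a4) * t - (2 * a2 + 2 * a3 + a4))) := by
  obtain ⟨u, rfl⟩ : ∃ u, a1 = u * x := ⟨a1 / x, by field_simp⟩
  rw [mul_div_cancel_right₀ _ hx]
  unfold H
  ring

/-- The chain rule for `H` along a curve in the `(x, y)`-plane. -/
theorem hasDerivAt_H_comp (a0 a1 a2 a3 a4 t z w : ℂ) {f g : ℂ → ℂ} {f' g' s : ℂ}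
    (hf : HasDerivAt f f' s) (hg : HasDerivAt g g' s) :
    HasDerivAt (fun r => H a0 a1 a2 a3 a4 t (f r) (g r) z w)
      (Hx a0 a1 a2 a3 a4 t (f s) (g s) z w * f' + Hy a0 a1 a2 a3 a4 t (f s) (g s) z w * g') s := by
  have hF : DifferentiableAt ℂ (fun p : ℂ × ℂ => H a0 a1 a2 a3 a4 t p.1 p.2 z w) (f s, g s) := by
    unfold H
    fun_prop
  have along {u v : ℂ → ℂ} {u' v' r : ℂ} (hu : HasDerivAt u u' r) (hv : HasDerivAt v v' r)
      (h : (u r, v r) = (f s, g s)) :=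
    (h ▸ hF.hasFDerivAt).comp_hasDerivAt r (hu.prodMk hv)
  have hX := (along (hasDerivAt_id (f s)) (hasDerivAt_const (f s) (g s)) rfl).deriv
  have hY := (along (hasDerivAt_const (g s) (f s)) (hasDerivAt_id (g s)) rfl).deriv
  refine (along hf hg rfl).congr_deriv ?_
  rw [show Hx a0 a1 a2 a3 a4 t (f s) (g s) z w = _ from hX,
    show Hy a0 a1 a2 a3 a4 t (f s) (g s) z w = _ from hY, mul_comm _ f', mul_comm _ g',
    ← smul_eq_mul, ← smul_eq_mul, ← map_smul, ← map_smul, id, id, ← map_add]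
  simp

theorem Hy_s1 (a0 a1 a2 a3 a4 t x y z w : ℂ) (hx : x ≠ 0) :
    Hy (a0 + a1) (-a1) (a2 + a1) a3 a4 t x (y - a1 / x) z w = Hy a0 a1 a2 a3 a4 t x y z w := by
  unfold Hy
  rw [← deriv_comp_sub_const (fun s => H (a0 + a1) (-a1) (a2 + a1) a3 a4 t x s z w)]
  simp only [H_s1 _ _ _ _ _ _ _ _ _ _ hx, deriv_add_const]

theorem Hz_s1 (a0 a1 a2 a3 a4 t x y z w : ℂ) (hx : x ≠ 0) :
    Hz (a0 + a1) (-a1) (a2 + a1) a3 a4 t x (y - a1 / x) z w = Hz a0 a1 a2 a3 a4 t x y z w := by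
  simp only [Hz, H_s1 _ _ _ _ _ _ _ _ _ _ hx, deriv_add_const]

theorem Hw_s1 (a0 a1 a2 a3 a4 t x y z w : ℂ) (hx : x ≠ 0) :
    Hw (a0 + a1) (-a1) (a2 + a1) a3 a4 t x (y - a1 / x) z w = Hw a0 a1 a2 a3 a4 t x y z w := by
  simp only [Hw, H_s1 _ _ _ _ _ _ _ _ _ _ hx, deriv_add_const]

theorem Hx_s1 (a0 a1 a2 a3 a4 t x y z w : ℂ) (hx : x ≠ 0) :
    Hx (a0 + a1) (-a1) (a2 + a1) a3 a4 t x (y - a1 / x) z w =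
      Hx a0 a1 a2 a3 a4 t x y z w - a1 / x ^ 2 * Hy a0 a1 a2 a3 a4 t x y z w := by
  have hg : HasDerivAt (fun s => y - a1 / s) (a1 / x ^ 2) x :=
    (((hasDerivAt_const x a1).div (hasDerivAt_id x) hx).const_sub y).congr_deriv (by simp; ring)
  have h := hasDerivAt_H_comp (a0 + a1) (-a1) (a2 + a1) a3 a4 t z w (hasDerivAt_id x) hg
  have hold := (hasDerivAt_H_comp a0 a1 a2 a3 a4 t z w (hasDerivAt_id x)
    (hasDerivAt_const x y)).add_const ((t * (1 - t))⁻¹ * ((1 - 2 * t) * a1 ^ 2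
          - a1 * ((4 * a2 + 3 * a3 + a4) * t - (2 * a2 + 2 * a3 + a4))))
  have key := (hold.congr_of_eventuallyEq ((eventually_ne_nhds hx).mono
    fun s hs => H_s1 a0 a1 a2 a3 a4 t s y z w hs)).unique h
  simp only [id, Hy_s1 _ _ _ _ _ _ _ _ _ _ hx] at key
  linear_combination -key


/-- Bäcklund transformation `s₁`: if `(x, y, z, w)` solves the coupled Painlevé VI system with parameters `(α₀, α₁, α₂, α₃, α₄)` on a domain avoiding `t ∈ {0, 1}` with `x ≠ 0`, then `(x, y - α₁/x, z, w)` solves the system with parameters `(α₀+α₁, -α₁, α₂+α₁, α₃, α₄)`. -/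
theorem backlund_s1
    (a0 a1 a2 a3 a4 : ℂ) (hparam : a0 + 2 * a1 + 3 * a2 + 2 * a3 + a4 = 1)
    (U : Set ℂ) (hU : ∀ t ∈ U, t ≠ 0 ∧ t ≠ 1)
    (x y z w : ℂ → ℂ)
    (hx0 : ∀ t ∈ U, x t ≠ 0)
    (hx : ∀ t ∈ U, HasDerivAt x (Hy a0 a1 a2 a3 a4 t (x t) (y t) (z t) (w t)) t)
    (hy : ∀ t ∈ U, HasDerivAt y (-Hx a0 a1 a2 a3 a4 t (x t) (y t) (z t) (w t)) t)
    (hz : ∀ t ∈ U, HasDerivAt z (Hw a0 a1 a2 a3 a4 t (x t) (y t) (z t) (w t)) t)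
    (hw : ∀ t ∈ U, HasDerivAt w (-Hz a0 a1 a2 a3 a4 t (x t) (y t) (z t) (w t)) t) :
    (∀ t ∈ U, HasDerivAt x
        (Hy (a0 + a1) (-a1) (a2 + a1) a3 a4 t (x t) (y t - a1 / x t) (z t) (w t)) t) ∧
    (∀ t ∈ U, HasDerivAt (fun s => y s - a1 / x s)
        (-Hx (a0 + a1) (-a1) (a2 + a1) a3 a4 t (x t) (y t - a1 / x t) (z t) (w t)) t) ∧
    (∀ t ∈ U, HasDerivAt z
        (Hw (a0 + a1) (-a1) (a2 + a1) a3 a4 t (x t) (y t - a1 / x t) (z t) (w t)) t) ∧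
    (∀ t ∈ U, HasDerivAt w
        (-Hz (a0 + a1) (-a1) (a2 + a1) a3 a4 t (x t) (y t - a1 / x t) (z t) (w t)) t) := by
  refine ⟨fun t ht => ?_, fun t ht => ?_, fun t ht => ?_, fun t ht => ?_⟩
  · rw [Hy_s1 _ _ _ _ _ _ _ _ _ _ (hx0 t ht)]
    exact hx t ht
  · rw [Hx_s1 _ _ _ _ _ _ _ _ _ _ (hx0 t ht)]
    refine ((hy t ht).sub ((hasDerivAt_const t a1).div (hx t ht) (hx0 t ht))).congr_deriv ?_
    ring
  · rw [Hw_s1 _ _ _ _ _ _ _ _ _ _ (hx0 t ht)]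
    exact hz t ht
  · rw [Hz_s1 _ _ _ _ _ _ _ _ _ _ (hx0 t ht)]
    exact hw t ht
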